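/- There do not exist real numbers A, B, u, p, t with A > 0 and B > 0 satisfying E₀ = E₂ = E₃ = E₄ = E₅ = E₆ = 0, where E₀ := B(B + pu + t + t²)² + Ap²(B + t²) − AB; E₂ := 2Bp + 2pt² + 2pt + 3tu + 2u; E₃ := 3A + 2Bp² + 2Bt + 2B + 2p²t² + 10ptu + 4pu + 2t³ + 7t² + 4t + 3u²; E₄ := 8Ap + 5Bpt + 4Bp + Bu + 7p²tu + 5pt³ + 14pt² + 4pt + 8pu² + 8t²u + 17tu + 4u; E₅ := 15Ap² + 15At + 15A + 10Bp²t + 4Bp² + 8Bpu + 5Bt² + 10Bt + 4B + 10p²t³ + 21p²t² + 15p²u² + 53pt²u + 92ptu + 8pu + 5t⁴ + 27t³ + 35t² + 24tu² + 8t + 25u²; E₆ := 120Apt + 96Ap + 24Au + 10Bp³t + 26Bp²u + 40Bpt² + 66Bpt + 16Bp + 18Btu + 18Bu + 10p³t³ + 136p²t²u + 164p²tu + 40pt⁴ + 196pt³ + 204pt² + 208ptu² + 16pt + 172pu² + 73t³u + 274t²u + 220tu + 24u³ + 16u. -/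

import Mathlib

theorem case_t_zero (A B u p : ℝ) (hA : 0 < A) (hB : 0 < B) (hp : p ≠ 0)
  (h0 : B * (B + p * u) ^ 2 + A * p ^ 2 * B - A * B = 0)
  (h2 : 2 * B * p + 2 * u = 0)
  (h3 : 3 * A + 2 * B * p ^ 2 + 2 * B + 4 * p * u + 3 * u ^ 2 = 0)
  (h4 : 8 * A * p + 4 * B * p + B * u + 8 * p * u ^ 2 + 4 * u = 0) : False := by
  obtain rfl : u = -(B*p) := by linarith
  have e3 : 3 * A = B * (2*p^2 - 2 - 3*B*p^2) := by linarith
  have e4 : 8 * A = B^2*(1-8*p^2) := by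
    apply mul_left_cancel₀ hp; linarith
  have e5 : 16*p^2 - 16 = 3 * B := by
    apply mul_left_cancel₀ hB.ne'; linarith
  have e6 : (B^2 * (1-p^2) - A) * (B * (1-p^2)) = 0 := by linarith
  have : 0 < p^2-1 := by linarith
  rcases mul_eq_zero.1 e6 with h | h
  · have := mul_pos (pow_pos hB 2) this
    linarith
  · have := mul_pos hB this
    linarith

theorem case_p_zero (A B u t : ℝ) (hA : 0 < A) (hB : 0 < B)
  (h0 : B * (B + t + t ^ 2) ^ 2 - A * B = 0)
  (h2 : 3 * t * u + 2 * u = 0)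
  (h3 : 3 * A + 2 * B * t + 2 * B + 2 * t ^ 3 + 7 * t ^ 2 + 4 * t + 3 * u ^ 2 = 0)
  (h4 : B * u + 8 * t ^ 2 * u + 17 * t * u + 4 * u = 0)
  (h5 : 15 * A * t + 15 * A + 5 * B * t ^ 2 + 10 * B * t + 4 * B + 5 * t ^ 4
        + 27 * t ^ 3 + 35 * t ^ 2 + 24 * t * u ^ 2 + 8 * t + 25 * u ^ 2 = 0) : False := by
  have hA' : A = (B+t+t^2)^2 := by
    apply mul_left_cancel₀ hB.ne'; linarith
  by_cases hu : u = 0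
  · subst hu
    have e1 : B*(5*t^2+10*t+6) = -t*(5*t^3+18*t^2+20*t+12) := by linear_combination 5*(t+1)*h3 - h5
    have e2 : t^2*(72*t^4+292*t^3+560*t^2+480*t+216) = 0 := by
      have f1 : (B+t+t^2)*(5*t^2+10*t+6) = -t*(3*t^2+4*t+6) := by linear_combination e1
      have f2 : A*(5*t^2+10*t+6)^2 = (t*(3*t^2+4*t+6))^2 := by
        rw [hA', ← mul_pow, f1]; ring
      linear_combination (5*t^2+10*t+6)^2*h3 - 3*f2 - 2*(t+1)*(5*t^2+10*t+6)*e1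
    rcases mul_eq_zero.1 e2 with h | h
    · have ht : t = 0 := by simpa using h
      subst ht
      linarith
    · nlinarith [sq_nonneg (t*(t+2)), sq_nonneg (t+1), sq_nonneg (t*(36*t+73)), sq_nonneg (6*t^2+12*t+5), sq_nonneg (t^2+2*t+1)]
  · obtain rfl : t = -2/3 := by
      have : 3*t+2 = 0 := by apply mul_left_cancel₀ hu; linarith
      linarith
    nlinarith [sq_nonneg u]

set_option maxHeartbeats 4000000 in
theorem t_pow_four (A B w P t : ℝ) 
  (h0 : B * (B + P * w + t + t ^ 2) ^ 2 + A * P * (B + t ^ 2) - A * B = 0)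
  (h2 : 2 * B + 2 * t ^ 2 + 2 * t + 3 * t * w + 2 * w = 0)
  (h3 : 3 * A + 2 * B * P + 2 * B * t + 2 * B + 2 * P * t ^ 2
        + 10 * P * t * w + 4 * P * w + 2 * t ^ 3 + 7 * t ^ 2 + 4 * t
        + 3 * P * w ^ 2 = 0)
  (h4 : 8 * A + 5 * B * t + 4 * B + B * w + 7 * P * t * w
        + 5 * t ^ 3 + 14 * t ^ 2 + 4 * t + 8 * P * w ^ 2
        + 8 * t ^ 2 * w + 17 * t * w + 4 * w = 0)
  (h5 : 15 * A * P + 15 * A * t + 15 * A + 10 * B * P * t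
        + 4 * B * P + 8 * B * P * w + 5 * B * t ^ 2 + 10 * B * t + 4 * B
        + 10 * P * t ^ 3 + 21 * P * t ^ 2 + 15 * P ^ 2 * w ^ 2
        + 53 * P * t ^ 2 * w + 92 * P * t * w + 8 * P * w + 5 * t ^ 4
        + 27 * t ^ 3 + 35 * t ^ 2 + 24 * t * P * w ^ 2 + 8 * t + 25 * P * w ^ 2 = 0)
  (h6 : 120 * A * t + 96 * A + 24 * A * w + 10 * B * P * t
        + 26 * B * P * w + 40 * B * t ^ 2 + 66 * B * t + 16 * B
        + 18 * B * t * w + 18 * B * w + 10 * P * t ^ 3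
        + 136 * P * t ^ 2 * w + 164 * P * t * w + 40 * t ^ 4
        + 196 * t ^ 3 + 204 * t ^ 2 + 208 * P * t * w ^ 2 + 16 * t
        + 172 * P * w ^ 2 + 73 * t ^ 3 * w + 274 * t ^ 2 * w + 220 * t * w
        + 24 * P * w ^ 3 + 16 * w = 0) : t ^ 4 = 0 := by
  obtain rfl : B = -(2 * t ^ 2 + 2 * t + 3 * t * w + 2 * w)/2 := by linarith
  obtain rfl : A = -((-(2 * t ^ 2 + 2 * t + 3 * t * w + 2 * w)) * (P + t + 1) + 2 * P * t ^ 2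
        + 10 * P * t * w + 4 * P * w + 2 * t ^ 3 + 7 * t ^ 2 + 4 * t
        + 3 * P * w ^ 2)/3 := by linarith
  linear_combination (exp := 1)
      (((1110449200865053138252454608049884901938716500987157005940000)*P^1*w^4*t^1 +
      (-291492915227076448791269334613094786758913081509128714059250)*w^4*t^2 +
      (-5791194823043525517146496576292942440678558711203849061959428500)*P^1*w^3*t^2 +
      (1521097474316758440178793844595173218352552129977287055076399000)*w^3*t^3 +
      (-55365569085638006066540143647422327070124336766305060039236774450)*P^1*w^2*t^3 +
      (27101758966174484534918043666608658079002822559121775325191138150)*w^2*t^4 +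
      (18543394511907129499759867054430034352947736295765613251296661250)*P^1*w^1*t^4 +
      (-6541360309850111597514529767947291479375616102207085379931295000)*w^1*t^5 +
      (-351642246940600160446610625882463552280593558645933051881000)*P^1*w^4 +
      (21610101772591048908039767674909699048375724689712034372192280860)*P^1*w^3*t^1 +
      (-23271862857666559434764663793319794330928455429900662723203214680)*P^1*w^2*t^2 +
      (-174122771773448721134225922939797346827895692451214416310312233700)*P^1*w^1*t^3 +
      (60939236709965294737659981942143161823388442593801769968794767500)*P^1*t^4 +
      (-388657220302768598388359112817459715678550775345504952079000)*w^4*t^1 +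
      (-130829211669877789871185791774658235054053638817492847231821800)*w^3*t^2 +
      (36157682060807156689618739659571256108851315896640425316133309420)*w^2*t^3 +
      (10311041446694362501561876074355291253108478699681316989209873050)*w^1*t^4 +
      (-10320545641202453005913754364488401359807912910484435018228813840)*P^1*w^3 +
      (-354394578069110033757318812282010308440237324018935333067757378136)*P^1*w^2*t^1 +
      (-280970537526300607014023269482056648698553793144507432724269586760)*P^1*w^1*t^2 +
      (1663690661995709202536914384934999977816434932173458227154583840)*P^1*t^3 +
      (-129552406767589532796119704272486571892850258448501650693000)*w^4 +
      (-2202352993970902324178645982319321126922319607962292366993139400)*w^3*t^1 +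
      (5097203138673975987032720748017464944203844748615512923518161808)*w^2*t^2 +
      (348295301552235730233646096339114254988675269493874513526616792600)*w^1*t^3 +
      (-17589285861128321275543155521462940653869160934535457478454294460)*t^4 +
      (-132055554409386838882804417629821329726687923110816286994892293632)*P^1*w^2 +
      (1504386352456687861084966896975431761177443325730197190386034886608)*P^1*w^1*t^1 +
      (252236319279915216077416764905640630521899140178421308653091033712)*P^1*t^2 +
      (-959393465070505216123372126803351693227136749544187111054942800)*w^3 +
      (-12550324901183981416022976802656116725954629487241669840544834420)*w^2*t^1 +
      (164773879082391174981033358145181183030246490579516270571391975384)*w^1*t^2 +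
      (-77099305522831673032546695547298568875846703694553045767382714048)*t^3 +
      (532777585514914115056110385832466773307008093739046481387967099648)*P^1*w^1 +
      (-379249995335938430421380345537545928048407620033984385896572206848)*P^1*t^1 +
      (-5275312054435683147929006716526205817472440341533393133774764248)*w^2 +
      (-309165528212071923245497705862003724023455819313524625596433042632)*w^1*t^1 +
      (-3104335690201328911477780806925002320534457445379046637326848160)*t^2 +
      (-410280485270850230014052102892701599600554772610403548213129256960)*P^2*w^1 +
      (300911047445037911880593555169558896363914385589932050059796124160)*P^2*t^1 +
      (14171595479579167317753938162042732558730738716249821131585000)*P^2*w^3 +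
      (35233883391340221848736813601568099646589954072073070211779414300)*P^2*w^2*t^1 +
      (356811393966210152500910567621649204671845336772138407598611965400)*P^2*w^2 +
      (-304148408992976736498173943844331892298856780528579237641426756360)*P^2*w^1*t^1 +
      (-56732926014116777140781582625278477616450251793920565521999262800)*P^2*t^2 +
      (-124396593485814676208419857894589876615361807327721954487728242688)*w^1 +
      (80234577113898275467546139369685734301050931620073824594793650688)*t^1 +
      (-1382766284309403590628057610221381275572789154777346107428434600)*P^2*w^1*t^2 +
      (-67300243413562727125622812899532488113488091558404603001830500000)*P^2*t^3 +
      (-20483247101401888658315582114506523048797817532432191656120110000)*t^5 +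
      (19924392939929877488884850771747879008697462719277677872266832000)*P^3*w^1*t^1 +
      (1897561232374274046560461978261702762733091687550255035453984000)*P^3*w^1 +
      (-1897561232374274046560461978261702762733091687550255035453984000)*P^3*t^1)*h4 +
      ((-360895990281142269932047747616212593130082862820826026930500)*w^4*t^1 +
      (1881999742682621174983066966397243401333810478811231922835448000)*w^3*t^2 +
      (18360910826265738929932871002646692467295286026543968020391747150)*w^2*t^3 +
      (-6170566672353437021699100252570487969369916060213373398880113750)*w^1*t^4 +
      (-240597326854094846621365165077475062086721908547217351287000)*w^4 +
      (-7199682063917124853750711135752017493641108771814777116716562730)*w^3*t^1 +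
      (-4407634329300387617112541978668718301846996185105861423716530070)*w^2*t^2 +
      (50415340199009952488977404125996532705736919041546349573762547300)*w^1*t^3 +
      (23672930213940630679601844240199377651677433733770585428630717500)*t^4 +
      (-5637210184905565485395242820318874878336639874933768178990360320)*w^3 +
      (62669220335712363998746653928007300864483365085308134125123200024)*w^2*t^1 +
      (83576796986438929129420162446115270304186238937146963758421733620)*w^1*t^2 +
      (10278426143949518694039228139871228057836977506676882795051017960)*t^3 +
      (24829310376970374368953566743579842152403937653523067111760601976)*w^2 +
      (-332669062735842969325604428885054473780778701838102366558850431040)*w^1*t^1 +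
      (-205020205284988251492178895893605146190643756407916794612209899352)*t^2 +
      (76578732499812076572976436471939229725000035334645716569926977792)*P^1*w^1 +
      (-58154554547952827458443784860518794919955641062025843333269288192)*P^1*t^1 +
      (-4881327331855046520559689811370274548007254446708271723101500)*P^1*w^3 +
      (-116305868237026357880973348067749446414057977395506243988819067640)*P^1*w^2 +
      (-81764219195904998504807685726843828298252189301348834275067835392)*w^1 +
      (50945217205035848445814833159530935638252122018772316510026004992)*t^1 +
      (94438713528249549361764607165131075856482660862333940058023415960)*P^1*t^2 +
      (-19068402300509439352259796988200871632154959274881304183851975000)*P^1*t^3 +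
      (5186667368489682393931929407248654218137117279304030430240889600)*P^2*w^1 +
      (7210732683022241376929755517394470498385748412690969134725139200)*P^2*t^1)*h5 +
      ((831932561412332245287471054516768135099046664582357547086755875)*w^1*t^4 +
      (-3050059672189832553970799078687233903663546190859984805907107575)*w^2*t^3 +
      (-323898566007823736409469858725507529484981993597804963530932750)*t^4 +
      (-3855203177783776806929577713282728880618669586802102993168028150)*w^1*t^3 +
      (859051587131498409429411654659704997494787360514475716795582690)*w^2*t^2 +
      (575484802545687784757264597836874540405479295268143539836000)*P^1*w^3 +
      (-6997900474138218749198911515392355393378833229139110559890418500)*P^1*t^3 +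
      (867317399383482308253038150907228568334520227793147943891080480)*t^3 +
      (-22881924360564427262105155627229996382576105973456475069271795580)*w^1*t^2 +
      (131407294888883309690319930161751558963285704480584905213439856)*w^2*t^1 +
      (13772925064315676192411042789456947330337620143686144377879058000)*P^1*w^2 +
      (-4690295115227170487338315848756351945563600992256270017410358920)*P^1*t^2 +
      (19052836743130388632833506956485213415572145023879039218084252112)*t^2 +
      (25843602024188320061044225956689464160214548569334225579166332640)*w^1*t^1 +
      (-1197661024472540391123312614796616722219572284608589746356658036)*w^2 +
      (32455982698174797683548766592618108288383082123335064248359251792)*P^1*t^1 +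
      (-35441711929143866856486338195471499769954023376169870289439427792)*P^1*w^1 +
      (787310859976620406541885453446818475485041039791656729532500)*P^2*w^2 +
      (-12654912077182424684654006482632412246388134968974099981825197192)*t^1 +
      (16839195135381859023297354434988189449026872462936906161154174792)*w^1 +
      (-19801258455237312163319868316040432167317554954092927654618150600)*P^2*t^1 +
      (18602382626444194144313906470444213088553859627710133136796613000)*P^2*w^1 +
      (7851695064915651497989328171612123613240277348480537016880225000)*P^2*t^2)*h6 +
      ((129552406767589532796119704272486571892850258448501650693000)*w^3 +
      (114487987653003929974082008939447280500584405891972152906635680000) +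
      (113045214622496830212338518299101618906879538295901366196939991200)*t^1 +
      (-30631161950954568870926746067283053323862461591829827173584452000)*w^1 +
      (-208073655828231483836785253299818571091111578399671085414241318400)*P^1 +
      (27709330681804493674932221997495196190610911002087154901605233600)*t^2 +
      (-14464846022854187967780556218925414470873617744636492840929470000)*w^1*t^1 +
      (957345303211131895890595377192948572185783116886810799243986800)*w^2 +
      (-100029642196606681997426284443323531419378856585025976513215690400)*P^1*t^1 +
      (9072785231772927457554060311239406650098802829586356182608048800)*P^1*w^1 +
      (92980500386339428281462636934823435373921492689962496737245216000)*P^2 +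
      (147907642618486028425309384686662075910611203918967588396160000)*t^3 +
      (-1319904165257016624793809650917165118446233871141394564287154000)*w^1*t^2 +
      (-677579443313089296920713159805657104493260615594048702781061000)*w^2*t^1)*h0)/214667708501902200123664062555571797266056836529586381824000

/-- Final algebraic obstruction in Case (VII): the system
`E₀ = E₂ = E₃ = E₄ = E₅ = E₆ = 0` has no solution with `A > 0` and `B > 0`. -/
theorem case_VII_algebraic_system_impossible :
    ¬ ∃ A B u p t : ℝ, 0 < A ∧ 0 < B ∧
      B * (B + p * u + t + t ^ 2) ^ 2 + A * p ^ 2 * (B + t ^ 2) - A * B = 0 ∧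
      2 * B * p + 2 * p * t ^ 2 + 2 * p * t + 3 * t * u + 2 * u = 0 ∧
      3 * A + 2 * B * p ^ 2 + 2 * B * t + 2 * B + 2 * p ^ 2 * t ^ 2
        + 10 * p * t * u + 4 * p * u + 2 * t ^ 3 + 7 * t ^ 2 + 4 * t
        + 3 * u ^ 2 = 0 ∧
      8 * A * p + 5 * B * p * t + 4 * B * p + B * u + 7 * p ^ 2 * t * u
        + 5 * p * t ^ 3 + 14 * p * t ^ 2 + 4 * p * t + 8 * p * u ^ 2
        + 8 * t ^ 2 * u + 17 * t * u + 4 * u = 0 ∧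
      15 * A * p ^ 2 + 15 * A * t + 15 * A + 10 * B * p ^ 2 * t
        + 4 * B * p ^ 2 + 8 * B * p * u + 5 * B * t ^ 2 + 10 * B * t + 4 * B
        + 10 * p ^ 2 * t ^ 3 + 21 * p ^ 2 * t ^ 2 + 15 * p ^ 2 * u ^ 2
        + 53 * p * t ^ 2 * u + 92 * p * t * u + 8 * p * u + 5 * t ^ 4
        + 27 * t ^ 3 + 35 * t ^ 2 + 24 * t * u ^ 2 + 8 * t + 25 * u ^ 2 = 0 ∧
      120 * A * p * t + 96 * A * p + 24 * A * u + 10 * B * p ^ 3 * t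
        + 26 * B * p ^ 2 * u + 40 * B * p * t ^ 2 + 66 * B * p * t + 16 * B * p
        + 18 * B * t * u + 18 * B * u + 10 * p ^ 3 * t ^ 3
        + 136 * p ^ 2 * t ^ 2 * u + 164 * p ^ 2 * t * u + 40 * p * t ^ 4
        + 196 * p * t ^ 3 + 204 * p * t ^ 2 + 208 * p * t * u ^ 2 + 16 * p * t
        + 172 * p * u ^ 2 + 73 * t ^ 3 * u + 274 * t ^ 2 * u + 220 * t * u
        + 24 * u ^ 3 + 16 * u = 0 := by
  rintro ⟨A, B, u, p, t, hA, hB, h0, h2, h3, h4, h5, h6⟩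
  by_cases hp : p = 0
  · subst hp
    apply case_p_zero A B u t hA hB <;> linarith
  obtain ⟨w, rfl⟩ : ∃ w, u = p * w := ⟨u / p, by field_simp⟩
  have ht : t ^ 4 = 0 := by
    apply t_pow_four A B w (p ^ 2) t
    · linear_combination h0
    · apply mul_left_cancel₀ hp; linear_combination h2
    · linear_combination h3
    · apply mul_left_cancel₀ hp; linear_combination h4
    · linear_combination h5
    · apply mul_left_cancel₀ hp; linear_combination h6
  have ht' : t = 0 := by simpa using ht
  subst ht'
  apply case_t_zero A B (p * w) p hA hB hp <;> linarith
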